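/- arXiv:2601.11799 — 2 statements merged into one kernel-verified Lean document; each statement's English description precedes it below -/
import Mathlib

section
/- Fix T ≥ 1 and let α be a quadratic irrational of height H. Let 𝒩 be the set of transition times N ≥ 0 with θ_N ∈ R and θ_{N+1} ∈ L, and for N ∈ 𝒩 let k(N) ≥ 1 be the length of the ensuing maximal L-run. Call N ∈ 𝒩 T-deep if k(N) ≥ N + 2 log₃ H + T. If N₀ < N₁ < ⋯ < N_{m−1} are T-deep transition times in increasing order, then for every j < m − 1 one has N_{j+1} ≥ 2 N_j + 2 log₃ H + T + 1. -/
/-- θ_n(α) = {3^n α}, the fractional part of 3^n α. -/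
noncomputable def theta (α : ℝ) (n : ℕ) : ℝ := Int.fract (3 ^ n * α)

/-- Doubling gaps between T-deep transition times: fix T ≥ 1 and a quadratic
irrational α of height H. If N₀ < N₁ < ⋯ < N_{m-1} are transition times
(θ_{N_j} ∈ R, θ_{N_j+1} ∈ L) whose maximal L-runs have lengths k(N_j)
satisfying the T-deepness condition k(N_j) ≥ N_j + 2log₃H + T, then
N_{j+1} ≥ 2N_j + 2log₃H + T + 1 for every j < m - 1. -/
theorem stmt11 (α : ℝ) (a b c : ℤ) (H : ℕ)
    (hirr : Irrational α) (ha : a ≠ 0)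
    (hroot : (a : ℝ) * α ^ 2 + (b : ℝ) * α + (c : ℝ) = 0)
    (hprim : Int.gcd a (Int.gcd b c) = 1)
    (hH : H = max a.natAbs (max b.natAbs c.natAbs))
    (T : ℝ) (hT : 1 ≤ T)
    (m : ℕ) (Nseq : ℕ → ℕ) (k : ℕ → ℕ)
    (hmono : ∀ i j, i < j → j < m → Nseq i < Nseq j)
    (htransR : ∀ j, j < m → theta α (Nseq j) ∈ Set.Ico (2/3 : ℝ) 1)
    (htransL : ∀ j, j < m → theta α (Nseq j + 1) ∈ Set.Ico (0 : ℝ) (1/3))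
    (hk1 : ∀ j, j < m → 1 ≤ k j)
    (hrun : ∀ j, j < m → ∀ i, 1 ≤ i → i ≤ k j →
      theta α (Nseq j + i) ∈ Set.Ico (0 : ℝ) (1/3))
    (hmax : ∀ j, j < m → theta α (Nseq j + k j + 1) ∉ Set.Ico (0 : ℝ) (1/3))
    (hdeep : ∀ j, j < m → (k j : ℝ) ≥ (Nseq j : ℝ) + 2 * Real.logb 3 (H : ℝ) + T) :
    ∀ j, j + 1 < m →
      (Nseq (j + 1) : ℝ) ≥ 2 * (Nseq j : ℝ) + 2 * Real.logb 3 (H : ℝ) + T + 1 := by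
  intro j hj
  have hlt : Nseq j < Nseq (j + 1) := hmono j (j + 1) j.lt_succ_self hj
  have hjm : j < m := Nat.lt_of_succ_lt hj
  have hgap : Nseq j + k j + 1 ≤ Nseq (j + 1) := by
    by_contra! hcon
    have hL := hrun j hjm (Nseq (j + 1) - Nseq j) (by omega) (by omega)
    rw [Nat.add_sub_cancel' hlt.le] at hL
    linarith [hL.2, (htransR (j + 1) hj).1]
  have hgap' : (Nseq j : ℝ) + k j + 1 ≤ Nseq (j + 1) := by exact_mod_cast hgap
  linarith [hdeep j hjm]
end

section
/- Fix a nonzero quadratic discriminant Δ and a finite set 𝒰 ⊂ ℤ \ {0}, and let K = ℚ(√Δ). Then there exist positive constants A and B, depending only on 𝒰 and K, such that for every irreducible polynomial f(X) = aX² + bX + c ∈ ℤ[X] of discriminant b² − 4ac = Δ and height H_f = max(|a|,|b|,|c|), every integer triple (p, n, u) with a p² + b p·3^n + c·3^{2n} = u, n ≥ 0 and u ∈ 𝒰 satisfies n ≤ A (log H_f)² + B. -/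
open Polynomial

/-- The integers `4 ^ j * binom (m - 1/2) j`. -/
def halfChoose : ℕ → ℕ → ℤ
  | 0, j => (-1) ^ j * (Nat.centralBinom j : ℤ)
  | _ + 1, 0 => 1
  | m + 1, j + 1 => halfChoose m (j + 1) + 4 * halfChoose m j

theorem halfChoose_zero_right (m : ℕ) : halfChoose m 0 = 1 := by
  cases m <;> simp [halfChoose]

theorem succ_mul_halfChoose_succ (m j : ℕ) :
    ((j : ℤ) + 1) * halfChoose m (j + 1) = (4 * m - 2 - 4 * j) * halfChoose m j := by
  induction m generalizing j with
  | zero =>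
    have h : ((j : ℤ) + 1) * (Nat.centralBinom (j + 1) : ℤ)
        = 2 * (2 * j + 1) * (Nat.centralBinom j : ℤ) := by
      exact_mod_cast Nat.succ_mul_centralBinom_succ j
    simp only [halfChoose]
    push_cast
    linear_combination (-1) ^ (j + 1) * h
  | succ m ih =>
    cases j with
    | zero =>
      have h := ih 0
      simp only [halfChoose, halfChoose_zero_right] at h ⊢
      push_cast at h ⊢
      linear_combination h
    | succ j =>
      have h := ih (j + 1)
      have h' := ih j
      simp only [halfChoose] at h h' ⊢
      push_cast at h h' ⊢
      linear_combination h + 4 * h'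

theorem abs_halfChoose_le (m j : ℕ) : |halfChoose m j| ≤ 2 ^ m * 4 ^ j := by
  induction m generalizing j with
  | zero =>
    simp only [halfChoose, abs_mul, abs_pow, abs_neg, abs_one, one_pow, one_mul, pow_zero,
      Nat.abs_cast]
    have : j.centralBinom ≤ 4 ^ j := by
      have h := Nat.choose_le_two_pow (2 * j) j
      rwa [pow_mul] at h
    exact_mod_cast this
  | succ m ih =>
    cases j with
    | zero =>
      simp only [halfChoose, abs_one, pow_zero, mul_one]
      exact one_le_pow₀ (by norm_num)
    | succ j =>
      simp only [halfChoose]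
      have h := abs_add_le (halfChoose m (j + 1)) (4 * halfChoose m j)
      rw [abs_mul, abs_of_pos (by norm_num : (0 : ℤ) < 4)] at h
      have h1 := ih (j + 1)
      have h2 := ih j
      rw [pow_succ] at h1 ⊢
      rw [pow_succ]
      linarith

theorem halfChoose_ne_zero (m j : ℕ) : halfChoose m j ≠ 0 := by
  induction j with
  | zero => simp [halfChoose_zero_right]
  | succ j ih =>
    intro h
    have h' := succ_mul_halfChoose_succ m j
    rw [h, mul_zero] at h'
    rcases mul_eq_zero.1 h'.symm with h' | h'
    · omega
    · exact ih h'

/-- Coefficients of the denominator of the `(a, b)` Padé approximant of `√(1 + 4 v)`. -/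
def padeDen (a b j : ℕ) : ℤ := ((a + b - j).choose a : ℤ) * halfChoose a j

/-- Coefficients of the product of the `(a, b)` Padé denominator with `√(1 + 4 v)`. -/
def padeProd (a b i : ℕ) : ℤ :=
  ∑ j ∈ Finset.range (i + 1), padeDen a b j * halfChoose 1 (i - j)

theorem padeDen_eq_zero {a b j : ℕ} (ha : 0 < a) (hj : b < j) : padeDen a b j = 0 := by
  simp [padeDen, Nat.choose_eq_zero_of_lt (show a + b - j < a by omega)]

theorem padeDen_self_ne_zero (a b : ℕ) : padeDen a b b ≠ 0 := by
  simp [padeDen, halfChoose_ne_zero]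

theorem succ_mul_padeDen_succ {a : ℕ} (b j : ℕ) (ha : 0 < a) :
    ((j : ℤ) + 1) * (a + b - j) * padeDen a b (j + 1)
      = (b - j) * (4 * a - 2 - 4 * j) * padeDen a b j := by
  rcases lt_or_ge j (a + b) with hj | hj
  · obtain ⟨r, hr⟩ : ∃ r, a + b = j + r + 1 := ⟨a + b - j - 1, by omega⟩
    have hb : (b : ℤ) = j + r + 1 - a := by omega
    have h1 : a + b - (j + 1) = r := by omega
    have h2 : a + b - j = r + 1 := by omega
    have hc : (r.choose a : ℤ) * (r + 1) = (r + 1).choose a * (r + 1 - a) := by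
      rcases le_or_gt a (r + 1) with h | h
      · have := Nat.choose_mul_succ_eq r a
        zify [h] at this
        exact this
      · rw [Nat.choose_eq_zero_of_lt h, Nat.choose_eq_zero_of_lt (by omega : r < a)]
        simp
    have hh := succ_mul_halfChoose_succ a j
    simp only [padeDen, h1, h2, hb]
    linear_combination (r + 1) * (r.choose a : ℤ) * hh
      + (4 * a - 2 - 4 * j) * halfChoose a j * hc
  · rw [padeDen_eq_zero ha (by omega), padeDen_eq_zero ha (by omega)]
    simp

theorem succ_mul_padeProd_succ {a : ℕ} (b i : ℕ) (ha : 0 < a) :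
    ((i : ℤ) + 1) * (a + b - i) * padeProd a b (i + 1)
      = (a - i) * (4 * b + 2 - 4 * i) * padeProd a b i := by
  obtain ⟨G, hG⟩ : ∃ G : ℕ → ℤ, ∀ j, G j =
      -(j : ℤ) * (a + b + 1 - j) * padeDen a b j * halfChoose 1 (i + 1 - j) := ⟨_, fun _ => rfl⟩
  have key : ∀ j ∈ Finset.range (i + 1),
      ((i : ℤ) + 1) * (a + b - i) * (padeDen a b j * halfChoose 1 (i + 1 - j))
        - (a - i) * (4 * b + 2 - 4 * i) * (padeDen a b j * halfChoose 1 (i - j))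
      = G (j + 1) - G j := by
    intro j hj
    obtain ⟨r, rfl⟩ : ∃ r, i = j + r := ⟨i - j, by have := Finset.mem_range.1 hj; omega⟩
    have h1 : j + r + 1 - j = r + 1 := by omega
    have h2 : j + r - j = r := by omega
    have h3 : j + r + 1 - (j + 1) = r := by omega
    have hh := succ_mul_halfChoose_succ 1 r
    have hq := succ_mul_padeDen_succ b j ha
    simp only [hG, h1, h2, h3]
    push_cast at hh ⊢
    linear_combination (a + b - 2 * j - r) * padeDen a b j * hh + halfChoose 1 r * hq
  have hs := Finset.sum_congr rfl key
  rw [Finset.sum_range_sub G, hG, hG, Finset.sum_sub_distrib, ← Finset.mul_sum, ← Finset.mul_sum] at hs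
  unfold padeProd
  rw [Finset.sum_range_succ _ (i + 1)]
  simp only [Nat.sub_self, halfChoose_zero_right] at hs ⊢
  push_cast at hs ⊢
  linear_combination hs

theorem padeProd_ne_zero {a b i : ℕ} (hi : i ≤ a) : padeProd a b i ≠ 0 := by
  induction i with
  | zero =>
    simp [padeProd, padeDen, halfChoose_zero_right, Nat.choose_eq_zero_iff]
  | succ i ih =>
    intro h
    have h' := succ_mul_padeProd_succ b i (by omega : 0 < a)
    rw [h, mul_zero] at h'
    rcases mul_eq_zero.1 h'.symm with h' | h'
    · rcases mul_eq_zero.1 h' with h' | h' <;> omega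
    · exact ih (by omega) h'

theorem padeProd_eq_zero {a b i : ℕ} (ha : 0 < a) (h1 : a < i) (h2 : i ≤ a + b) :
    padeProd a b i = 0 := by
  induction i, h1 using Nat.le_induction with
  | base =>
    have h := succ_mul_padeProd_succ b a ha
    simp only [sub_self, zero_mul] at h
    rcases mul_eq_zero.1 h with h | h
    · rcases mul_eq_zero.1 h with h | h <;> omega
    · exact h
  | succ i hi ih =>
    have h := succ_mul_padeProd_succ b i ha
    rw [ih (by omega), mul_zero] at h
    rcases mul_eq_zero.1 h with h | h
    · rcases mul_eq_zero.1 h with h | h <;> omega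
    · exact h

theorem abs_padeDen_le (a b j : ℕ) : |padeDen a b j| ≤ 2 ^ (2 * a + b) * 4 ^ j := by
  rw [padeDen, abs_mul, Nat.abs_cast]
  have h1 : ((a + b - j).choose a : ℤ) ≤ 2 ^ (a + b) := by
    have := (Nat.choose_le_two_pow (a + b - j) a).trans
      (Nat.pow_le_pow_right (by norm_num : 0 < 2) (by omega : a + b - j ≤ a + b))
    exact_mod_cast this
  calc ((a + b - j).choose a : ℤ) * |halfChoose a j| ≤ 2 ^ (a + b) * (2 ^ a * 4 ^ j) := by
        gcongr
        exact abs_halfChoose_le a j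
    _ = 2 ^ (2 * a + b) * 4 ^ j := by ring

theorem abs_padeProd_le (a b i : ℕ) : |padeProd a b i| ≤ 2 ^ (2 * a + b + 1) * 8 ^ i := by
  have h2 : (i : ℤ) + 1 ≤ 2 ^ i := by
    exact_mod_cast Nat.lt_two_pow_self (n := i)
  calc |padeProd a b i| ≤ ∑ j ∈ Finset.range (i + 1), |padeDen a b j * halfChoose 1 (i - j)| :=
        Finset.abs_sum_le_sum_abs _ _
    _ ≤ ∑ j ∈ Finset.range (i + 1), (2 ^ (2 * a + b + 1) * 4 ^ i : ℤ) := by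
        refine Finset.sum_le_sum fun j hj => ?_
        have hj' : j + (i - j) = i := by have := Finset.mem_range.1 hj; omega
        rw [abs_mul]
        calc _ ≤ (2 ^ (2 * a + b) * 4 ^ j) * (2 ^ 1 * 4 ^ (i - j) : ℤ) := by
              gcongr
              · exact abs_padeDen_le a b j
              · exact abs_halfChoose_le 1 _
          _ = 2 ^ (2 * a + b + 1) * 4 ^ (j + (i - j)) := by ring
          _ = _ := by rw [hj']
    _ = ((i : ℤ) + 1) * (2 ^ (2 * a + b + 1) * 4 ^ i) := by simp
    _ ≤ 2 ^ i * (2 ^ (2 * a + b + 1) * 4 ^ i) := by gcongr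
    _ = _ := by
        rw [show (8 : ℤ) = 2 * 4 by norm_num, mul_pow]; ring

/-- The numerator of the `(a, b)` Padé approximant of `√(1 + 4 v)`. -/
noncomputable def padeP (a b : ℕ) : ℤ[X] :=
  ∑ i ∈ Finset.range (a + 1), C (padeProd a b i) * X ^ i

/-- The denominator of the `(a, b)` Padé approximant of `√(1 + 4 v)`. -/
noncomputable def padeQ (a b : ℕ) : ℤ[X] :=
  ∑ j ∈ Finset.range (b + 1), C (padeDen a b j) * X ^ j

theorem coeff_padeP (a b i : ℕ) :
    (padeP a b).coeff i = if i ≤ a then padeProd a b i else 0 := by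
  simp [padeP, Polynomial.coeff_X_pow]

theorem coeff_padeQ {a : ℕ} (b j : ℕ) (ha : 0 < a) : (padeQ a b).coeff j = padeDen a b j := by
  have : (padeQ a b).coeff j = if j ≤ b then padeDen a b j else 0 := by
    simp [padeQ, Polynomial.coeff_X_pow]
  rw [this]
  split_ifs with h
  · rfl
  · exact (padeDen_eq_zero ha (not_le.1 h)).symm

theorem natDegree_padeP_le (a b : ℕ) : (padeP a b).natDegree ≤ a := by
  rw [Polynomial.natDegree_le_iff_coeff_eq_zero]
  intro i hi
  rw [coeff_padeP, if_neg (not_le.2 hi)]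

theorem natDegree_padeQ_le {a : ℕ} (b : ℕ) (ha : 0 < a) : (padeQ a b).natDegree ≤ b := by
  rw [Polynomial.natDegree_le_iff_coeff_eq_zero]
  intro i hi
  rw [coeff_padeQ b i ha, padeDen_eq_zero ha hi]

theorem X_pow_dvd_pade {a : ℕ} (b : ℕ) (ha : 0 < a) :
    (PowerSeries.X : PowerSeries ℤ) ^ (a + b + 1) ∣
      (padeQ a b : PowerSeries ℤ) * PowerSeries.mk (halfChoose 1) - (padeP a b : PowerSeries ℤ) := by
  rw [PowerSeries.X_pow_dvd_iff]
  intro i hi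
  have h : (PowerSeries.coeff i) ((padeQ a b : PowerSeries ℤ) * PowerSeries.mk (halfChoose 1))
      = padeProd a b i := by
    rw [PowerSeries.coeff_mul, Finset.Nat.sum_antidiagonal_eq_sum_range_succ_mk]
    simp [padeProd, coeff_padeQ b _ ha]
  rw [map_sub, h, Polynomial.coeff_coe, coeff_padeP]
  split_ifs with h'
  · simp
  · rw [padeProd_eq_zero ha (not_le.1 h') (by omega)]; simp

theorem exists_padeP_mul_padeQ_sub {a : ℕ} (b : ℕ) (ha : 0 < a) :
    ∃ c : ℤ, c ≠ 0 ∧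
      padeP a b * padeQ a (b + 1) - padeP a (b + 1) * padeQ a b = C c * X ^ (a + b + 1) := by
  refine ⟨padeProd a b a * padeDen a (b + 1) (b + 1),
    mul_ne_zero (padeProd_ne_zero le_rfl) (padeDen_self_ne_zero _ _), ?_⟩
  have hdvd : (PowerSeries.X : PowerSeries ℤ) ^ (a + b + 1) ∣
      ((padeP a b * padeQ a (b + 1) - padeP a (b + 1) * padeQ a b : ℤ[X]) : PowerSeries ℤ) := by
    have h1 := (X_pow_dvd_pade b ha).mul_left (padeQ a (b + 1) : PowerSeries ℤ)
    have h2 := ((pow_dvd_pow _ (by omega : a + b + 1 ≤ a + (b + 1) + 1)).trans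
      (X_pow_dvd_pade (b + 1) ha)).mul_left (padeQ a b : PowerSeries ℤ)
    have h3 := dvd_sub h2 h1
    convert h3 using 1
    push_cast
    ring
  rw [PowerSeries.X_pow_dvd_iff] at hdvd
  ext i
  rw [Polynomial.coeff_C_mul, Polynomial.coeff_X_pow]
  rcases lt_trichotomy i (a + b + 1) with hi | hi | hi
  · have := hdvd i hi
    rw [Polynomial.coeff_coe] at this
    simp [this, hi.ne]
  · subst hi
    rw [Polynomial.coeff_sub, add_assoc a b 1,
      Polynomial.coeff_mul_add_eq_of_natDegree_le (natDegree_padeP_le a b)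
        (natDegree_padeQ_le (b + 1) ha),
      Polynomial.coeff_eq_zero_of_natDegree_lt (p := padeP a (b + 1) * padeQ a b)]
    · simp [coeff_padeP, coeff_padeQ _ _ ha]
    · have := Polynomial.natDegree_mul_le_of_le (natDegree_padeP_le a (b + 1))
        (natDegree_padeQ_le b ha)
      omega
  · rw [if_neg hi.ne', mul_zero]
    apply Polynomial.coeff_eq_zero_of_natDegree_lt
    have h1 := Polynomial.natDegree_mul_le_of_le (natDegree_padeP_le a (b + 1))
        (natDegree_padeQ_le b ha)
    have h2 := Polynomial.natDegree_mul_le_of_le (natDegree_padeP_le a b)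
        (natDegree_padeQ_le (b + 1) ha)
    have := Polynomial.natDegree_sub_le (padeP a b * padeQ a (b + 1)) (padeP a (b + 1) * padeQ a b)
    omega

theorem sum_halfChoose_one_mul (i : ℕ) :
    ∑ j ∈ Finset.range (i + 3), halfChoose 1 j * halfChoose 1 (i + 2 - j) = 0 := by
  have step : ∀ i : ℕ, ((i : ℤ) + 1) *
      ∑ j ∈ Finset.range (i + 1 + 1), halfChoose 1 j * halfChoose 1 (i + 1 - j)
      = (4 - 4 * i) * ∑ j ∈ Finset.range (i + 1), halfChoose 1 j * halfChoose 1 (i - j) := by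
    intro i
    have h1 : ((i : ℤ) + 1) *
        ∑ j ∈ Finset.range (i + 1 + 1), halfChoose 1 j * halfChoose 1 (i + 1 - j)
        = ∑ j ∈ Finset.range (i + 1 + 1), (j : ℤ) * (halfChoose 1 j * halfChoose 1 (i + 1 - j))
        + ∑ j ∈ Finset.range (i + 1 + 1),
            ((i : ℤ) + 1 - j) * (halfChoose 1 j * halfChoose 1 (i + 1 - j)) := by
      rw [Finset.mul_sum, ← Finset.sum_add_distrib]
      exact Finset.sum_congr rfl fun j _ => by ring
    rw [h1, Finset.sum_range_succ', Finset.sum_range_succ _ (i + 1), Finset.mul_sum]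
    simp only [Nat.cast_zero, zero_mul, add_zero, Nat.cast_add, Nat.cast_one, sub_self]
    rw [← Finset.sum_add_distrib]
    refine Finset.sum_congr rfl fun j hj => ?_
    obtain ⟨r, rfl⟩ : ∃ r, i = j + r := ⟨i - j, by have := Finset.mem_range.1 hj; omega⟩
    have e1 : j + r + 1 - j = r + 1 := by omega
    have e2 : j + r - j = r := by omega
    have e3 : j + r + 1 - (j + 1) = r := by omega
    have hj' := succ_mul_halfChoose_succ 1 j
    have hr := succ_mul_halfChoose_succ 1 r
    rw [e1, e2, e3]
    push_cast at *
    linear_combination halfChoose 1 r * hj' + halfChoose 1 j * hr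
  induction i with
  | zero =>
    have h := step 1
    norm_num at h
    exact h
  | succ i ih =>
    have h := step (i + 2)
    rw [ih, mul_zero] at h
    rcases mul_eq_zero.1 h with h | h
    · omega
    · exact h

theorem abs_halfChoose_one_mul_pow_le {v : ℝ} (hv : |v| ≤ 1 / 16) (l : ℕ) :
    ‖(halfChoose 1 l : ℝ) * v ^ l‖ ≤ 2 * (1 / 4) ^ l := by
  have h : |(halfChoose 1 l : ℝ)| ≤ 2 ^ 1 * 4 ^ l := by exact_mod_cast abs_halfChoose_le 1 l
  rw [Real.norm_eq_abs, abs_mul, abs_pow]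
  calc |(halfChoose 1 l : ℝ)| * |v| ^ l ≤ (2 ^ 1 * 4 ^ l) * (1 / 16) ^ l := by gcongr
    _ = 2 * (1 / 4) ^ l := by rw [pow_one, mul_assoc, ← mul_pow]; norm_num

theorem summable_norm_halfChoose_one {v : ℝ} (hv : |v| ≤ 1 / 16) :
    Summable fun l : ℕ => ‖(halfChoose 1 l : ℝ) * v ^ l‖ :=
  Summable.of_nonneg_of_le (fun _ => norm_nonneg _) (abs_halfChoose_one_mul_pow_le hv)
    ((summable_geometric_of_lt_one (by norm_num) (by norm_num)).mul_left 2)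

theorem tsum_halfChoose_one {v : ℝ} (hv : |v| ≤ 1 / 16) :
    ∑' l : ℕ, (halfChoose 1 l : ℝ) * v ^ l = √(1 + 4 * v) := by
  have hs := summable_norm_halfChoose_one hv
  have hsq : (∑' l : ℕ, (halfChoose 1 l : ℝ) * v ^ l) * ∑' l : ℕ, (halfChoose 1 l : ℝ) * v ^ l
      = 1 + 4 * v := by
    rw [tsum_mul_tsum_eq_tsum_sum_range_of_summable_norm hs hs]
    have hc : ∀ i : ℕ, ∑ j ∈ Finset.range (i + 1),
        (halfChoose 1 j : ℝ) * v ^ j * ((halfChoose 1 (i - j) : ℝ) * v ^ (i - j))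
        = ((∑ j ∈ Finset.range (i + 1), halfChoose 1 j * halfChoose 1 (i - j) : ℤ) : ℝ)
          * v ^ i := by
      intro i
      push_cast
      rw [Finset.sum_mul]
      refine Finset.sum_congr rfl fun j hj => ?_
      have : v ^ i = v ^ j * v ^ (i - j) := by
        rw [← pow_add]; congr 1; have := Finset.mem_range.1 hj; omega
      rw [this]; ring
    simp_rw [hc]
    rw [tsum_eq_sum (s := Finset.range 2)]
    · norm_num [Finset.sum_range_succ, halfChoose, Nat.centralBinom]
    · intro i hi
      obtain ⟨r, rfl⟩ : ∃ r, i = r + 2 := ⟨i - 2, by simp at hi; omega⟩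
      rw [sum_halfChoose_one_mul]; simp
  have hpos : 0 ≤ ∑' l : ℕ, (halfChoose 1 l : ℝ) * v ^ l := by
    rw [hs.of_norm.tsum_eq_zero_add]
    have hg : HasSum (fun l : ℕ => (1 / 2 : ℝ) * (1 / 4) ^ l) (1 / 2 * (1 - 1 / 4)⁻¹) :=
      (hasSum_geometric_of_lt_one (by norm_num) (by norm_num)).mul_left _
    have hb := tsum_of_norm_bounded hg (f := fun l : ℕ => (halfChoose 1 (l + 1) : ℝ) * v ^ (l + 1))
      fun l => (abs_halfChoose_one_mul_pow_le hv (l + 1)).trans (by rw [pow_succ]; linarith)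
    rw [Real.norm_eq_abs] at hb
    have := (abs_le.1 hb).1
    simp only [halfChoose_zero_right]
    norm_num at *
    linarith
  rw [← hsq, Real.sqrt_mul_self hpos]

theorem aeval_padeP (a b : ℕ) (v : ℝ) :
    aeval v (padeP a b) = ∑ i ∈ Finset.range (a + 1), (padeProd a b i : ℝ) * v ^ i := by
  simp [padeP]

theorem aeval_padeQ (a b : ℕ) (v : ℝ) :
    aeval v (padeQ a b) = ∑ j ∈ Finset.range (b + 1), (padeDen a b j : ℝ) * v ^ j := by
  simp [padeQ]

theorem norm_padeDen_mul_pow_le (a b j : ℕ) {v : ℝ} (hv : |v| ≤ 1 / 16) :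
    ‖(padeDen a b j : ℝ) * v ^ j‖ ≤ 2 ^ (2 * a + b) * (1 / 2) ^ j := by
  have h : |(padeDen a b j : ℝ)| ≤ 2 ^ (2 * a + b) * 4 ^ j := by
    exact_mod_cast abs_padeDen_le a b j
  rw [Real.norm_eq_abs, abs_mul, abs_pow]
  calc |(padeDen a b j : ℝ)| * |v| ^ j ≤ (2 ^ (2 * a + b) * 4 ^ j) * (1 / 8) ^ j := by
        gcongr; linarith
    _ = 2 ^ (2 * a + b) * (1 / 2) ^ j := by rw [mul_assoc, ← mul_pow]; norm_num

theorem hasSum_padeDen {a : ℕ} (b : ℕ) (ha : 0 < a) (v : ℝ) :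
    HasSum (fun j : ℕ => (padeDen a b j : ℝ) * v ^ j) (aeval v (padeQ a b)) := by
  rw [aeval_padeQ]
  refine hasSum_sum_of_ne_finset_zero fun j hj => ?_
  rw [padeDen_eq_zero ha (by simp at hj; omega)]; simp

theorem abs_aeval_padeQ_le {a : ℕ} (b : ℕ) (ha : 0 < a) {v : ℝ} (hv : |v| ≤ 1 / 16) :
    |aeval v (padeQ a b)| ≤ 2 ^ (2 * a + b + 1) := by
  rw [← (hasSum_padeDen b ha v).tsum_eq, ← Real.norm_eq_abs, pow_succ]
  exact tsum_of_norm_bounded (hasSum_geometric_two.mul_left _)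
    fun j => norm_padeDen_mul_pow_le a b j hv

theorem abs_sqrt_mul_padeQ_sub_padeP_le {a : ℕ} (b : ℕ) (ha : 0 < a) {v : ℝ}
    (hv : |v| ≤ 1 / 16) :
    |√(1 + 4 * v) * aeval v (padeQ a b) - aeval v (padeP a b)|
      ≤ 2 ^ (2 * a + b + 2) * (8 * |v|) ^ (a + b + 1) := by
  have hs1 := summable_norm_halfChoose_one hv
  have hs2 : Summable fun j : ℕ => ‖(padeDen a b j : ℝ) * v ^ j‖ :=
    Summable.of_nonneg_of_le (fun _ => norm_nonneg _)
      (fun j => norm_padeDen_mul_pow_le a b j hv) (summable_geometric_two.mul_left _)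
  have hc : ∀ i : ℕ, ∑ j ∈ Finset.range (i + 1),
      (padeDen a b j : ℝ) * v ^ j * ((halfChoose 1 (i - j) : ℝ) * v ^ (i - j))
      = (padeProd a b i : ℝ) * v ^ i := by
    intro i
    rw [padeProd]
    push_cast
    rw [Finset.sum_mul]
    refine Finset.sum_congr rfl fun j hj => ?_
    have : v ^ i = v ^ j * v ^ (i - j) := by
      rw [← pow_add]; congr 1; have := Finset.mem_range.1 hj; omega
    rw [this]; ring
  have hbd : ∀ i : ℕ, ‖(padeProd a b i : ℝ) * v ^ i‖ ≤ 2 ^ (2 * a + b + 1) * (8 * |v|) ^ i := by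
    intro i
    have h : |(padeProd a b i : ℝ)| ≤ 2 ^ (2 * a + b + 1) * 8 ^ i := by
      exact_mod_cast abs_padeProd_le a b i
    rw [Real.norm_eq_abs, abs_mul, abs_pow, mul_pow, ← mul_assoc]
    gcongr
  have hs3 : Summable fun i : ℕ => (padeProd a b i : ℝ) * v ^ i := by
    refine Summable.of_norm_bounded ?_ hbd
    exact (summable_geometric_of_lt_one (by positivity) (by linarith)).mul_left _
  have hprod : √(1 + 4 * v) * aeval v (padeQ a b) = ∑' i : ℕ, (padeProd a b i : ℝ) * v ^ i := by
    rw [← tsum_halfChoose_one hv, ← (hasSum_padeDen b ha v).tsum_eq, mul_comm,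
      tsum_mul_tsum_eq_tsum_sum_range_of_summable_norm hs2 hs1]
    simp_rw [hc]
  have hP : aeval v (padeP a b) = ∑ i ∈ Finset.range (a + b + 1), (padeProd a b i : ℝ) * v ^ i := by
    rw [aeval_padeP]
    refine Finset.sum_subset (by intro i; simp; omega) fun i h1 h2 => ?_
    simp only [Finset.mem_range] at h1 h2
    rw [padeProd_eq_zero ha (by omega) (by omega)]; simp
  rw [hprod, hP, ← hs3.sum_add_tsum_nat_add (a + b + 1), add_sub_cancel_left, ← Real.norm_eq_abs]
  have hg := hasSum_geometric_two.mul_left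
    ((2 : ℝ) ^ (2 * a + b + 1) * (8 * |v|) ^ (a + b + 1))
  refine (tsum_of_norm_bounded hg fun i => (hbd _).trans ?_).trans (le_of_eq (by ring))
  rw [add_comm i, pow_add (8 * |v|), ← mul_assoc]
  have : (8 * |v|) ^ i ≤ (1 / 2) ^ i := by
    gcongr; linarith
  gcongr

theorem exists_int_pow_mul_sum (c : ℕ → ℤ) (N : ℕ) (m D : ℤ) (hD : D ≠ 0) :
    ∃ p : ℤ, (D : ℝ) ^ N * ∑ i ∈ Finset.range (N + 1), (c i : ℝ) * ((m : ℝ) / D) ^ i = p := by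
  refine ⟨∑ i ∈ Finset.range (N + 1), c i * m ^ i * D ^ (N - i), ?_⟩
  have hD' : (D : ℝ) ≠ 0 := by exact_mod_cast hD
  push_cast
  rw [Finset.mul_sum]
  refine Finset.sum_congr rfl fun i hi => ?_
  have : (D : ℝ) ^ N = D ^ i * D ^ (N - i) := by
    rw [← pow_add]; congr 1; have := Finset.mem_range.1 hi; omega
  rw [this, div_pow]
  field_simp

theorem pade_gap {Δ x₀ x : ℤ} {n₀ n a b : ℕ} (hΔ : 1 ≤ Δ) (hx₀ : 0 ≤ x₀) (hx : 0 ≤ x)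
    (ha : 0 < a) (hb : b ≤ a) (hn : 2 * n₀ * (a - b) ≤ n) {v : ℝ}
    (hvdef : v = ((x₀ ^ 2 - Δ * 9 ^ n₀ : ℤ) : ℝ) / ((4 * Δ * 9 ^ n₀ : ℤ) : ℝ))
    (hm₀ : 4 * |x₀ ^ 2 - Δ * 9 ^ n₀| ≤ Δ * 9 ^ n₀)
    (hne : (x : ℝ) * x₀ * aeval v (padeQ a b) - Δ * 3 ^ n₀ * 3 ^ n * aeval v (padeP a b) ≠ 0) :
    (3 : ℝ) ^ n * ((3 : ℝ) ^ n₀) ^ (2 * (a + 1)) ≤ 4 * Δ * (32 * Δ) ^ a * 3 ^ n₀ *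
      (|((x ^ 2 - Δ * 9 ^ n : ℤ) : ℝ)| * ((3 : ℝ) ^ n₀) ^ (2 * (a + b + 1))
        + ((3 : ℝ) ^ n) ^ 2 * (2 * |((x₀ ^ 2 - Δ * 9 ^ n₀ : ℤ) : ℝ)|) ^ (a + b + 1)) := by
  obtain ⟨m₀, hm₀def⟩ : ∃ m₀, m₀ = x₀ ^ 2 - Δ * 9 ^ n₀ := ⟨_, rfl⟩
  obtain ⟨m, hmdef⟩ : ∃ m, m = x ^ 2 - Δ * 9 ^ n := ⟨_, rfl⟩
  rw [← hm₀def] at hvdef hm₀ ⊢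
  rw [← hmdef]
  obtain ⟨t, ht⟩ : ∃ t : ℝ, t = 3 ^ n₀ := ⟨_, rfl⟩
  obtain ⟨T, hT⟩ : ∃ T : ℝ, T = 3 ^ n := ⟨_, rfl⟩
  have ht0 : 0 < t := by rw [ht]; positivity
  have hT0 : 0 < T := by rw [hT]; positivity
  have h9 : (9 : ℝ) ^ n₀ = t ^ 2 := by
    rw [ht, ← pow_mul, mul_comm, pow_mul]; norm_num
  have h9' : (9 : ℝ) ^ n = T ^ 2 := by
    rw [hT, ← pow_mul, mul_comm, pow_mul]; norm_num
  have hΔR : (1 : ℝ) ≤ Δ := by exact_mod_cast hΔ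
  have hD0 : 4 * Δ * 9 ^ n₀ ≠ 0 := by positivity
  have hm₀R : 4 * |(m₀ : ℝ)| ≤ Δ * t ^ 2 := by rw [← h9]; exact_mod_cast hm₀
  have hm₀x : (x₀ : ℝ) ^ 2 = Δ * t ^ 2 + m₀ := by rw [hm₀def, ← h9]; push_cast; ring
  have hmx : (x : ℝ) ^ 2 = Δ * T ^ 2 + m := by rw [hmdef, ← h9']; push_cast; ring
  obtain ⟨p, hp⟩ := exists_int_pow_mul_sum (padeProd a b) a m₀ _ hD0
  obtain ⟨q, hq⟩ := exists_int_pow_mul_sum (padeDen a b) b m₀ _ hD0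
  rw [← hvdef, ← aeval_padeP] at hp
  rw [← hvdef, ← aeval_padeQ] at hq
  have hDR : ((4 * Δ * 9 ^ n₀ : ℤ) : ℝ) = 4 * Δ * t ^ 2 := by rw [← h9]; push_cast; ring
  rw [hDR] at hp hq hvdef
  rw [← ht, ← hT] at hne ⊢
  have hv : |v| = |(m₀ : ℝ)| / (4 * Δ * t ^ 2) := by
    rw [hvdef, abs_div, abs_of_pos (by positivity : 0 < 4 * (Δ : ℝ) * t ^ 2)]
  have hv16 : |v| ≤ 1 / 16 := by
    rw [hv, div_le_iff₀ (by positivity)]; linarith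
  set Q := aeval v (padeQ a b) with hQ
  set P := aeval v (padeP a b) with hP
  -- the integer lower bound
  have hlow : t ^ (2 * (a - b)) ≤
      |(4 * (Δ : ℝ) * t ^ 2) ^ a * ((x : ℝ) * x₀ * Q - Δ * t * T * P)| := by
    have hTs : T = t ^ (2 * (a - b)) * 3 ^ (n - 2 * n₀ * (a - b)) := by
      rw [hT, ht, ← pow_mul, ← pow_add]
      congr 1
      have : n₀ * (2 * (a - b)) = 2 * n₀ * (a - b) := by ring
      omega
    have hsplit : (4 * (Δ : ℝ) * t ^ 2) ^ a
        = (4 * Δ) ^ (a - b) * t ^ (2 * (a - b)) * (4 * (Δ : ℝ) * t ^ 2) ^ b := by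
      rw [pow_mul t 2, ← mul_pow, ← pow_add]; congr 1; omega
    have hz : (4 * (Δ : ℝ) * t ^ 2) ^ a * ((x : ℝ) * x₀ * Q - Δ * t * T * P)
        = t ^ (2 * (a - b)) * (((4 * Δ) ^ (a - b) * x * x₀ * q
          - Δ * 3 ^ n₀ * 3 ^ (n - 2 * n₀ * (a - b)) * p : ℤ) : ℝ) := by
      have e1 : (4 * (Δ : ℝ) * t ^ 2) ^ a * ((x : ℝ) * x₀ * Q - Δ * t * T * P)
          = (4 * (Δ : ℝ) * t ^ 2) ^ a * Q * (x * x₀)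
            - Δ * t * T * ((4 * (Δ : ℝ) * t ^ 2) ^ a * P) := by ring
      rw [e1, hp, hsplit, mul_assoc _ _ Q, hq, hTs]
      push_cast
      rw [← ht]
      ring
    have hprod : (4 * (Δ : ℝ) * t ^ 2) ^ a * ((x : ℝ) * x₀ * Q - Δ * t * T * P) ≠ 0 :=
      mul_ne_zero (by positivity) hne
    rw [hz] at hprod ⊢
    rw [abs_mul, abs_of_pos (by positivity : 0 < t ^ (2 * (a - b)))]
    have h1 : (1 : ℝ) ≤ |(((4 * Δ) ^ (a - b) * x * x₀ * q
          - Δ * 3 ^ n₀ * 3 ^ (n - 2 * n₀ * (a - b)) * p : ℤ) : ℝ)| := by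
      have := Int.one_le_abs (Int.cast_ne_zero.1 (right_ne_zero_of_mul hprod))
      exact_mod_cast this
    exact le_mul_of_one_le_right (by positivity) h1
  -- the analytic upper bound
  have hx₀R : (0 : ℝ) ≤ x₀ := by exact_mod_cast hx₀
  have hxR : (0 : ℝ) ≤ x := by exact_mod_cast hx
  have hsqrt : (x₀ : ℝ) * √Δ = Δ * t * √(1 + 4 * v) := by
    have h1 : 0 ≤ 1 + 4 * v := by have := (abs_le.1 hv16).1; linarith
    rw [← sq_eq_sq₀ (by positivity) (by positivity), mul_pow, mul_pow, Real.sq_sqrt (by linarith),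
      Real.sq_sqrt h1, hm₀x, hvdef]
    field_simp
  have hx₀le : (x₀ : ℝ) ≤ 2 * Δ * t := by
    have h1 := le_abs_self (m₀ : ℝ)
    have h2 : 0 ≤ Δ * t ^ 2 := by positivity
    refine (sq_le_sq₀ hx₀R (by positivity)).1 ?_
    nlinarith
  have hsΔ : 1 ≤ √(Δ : ℝ) := Real.one_le_sqrt.2 hΔR
  have hxT : |(x : ℝ) - √Δ * T| ≤ |(m : ℝ)| / T := by
    have e : (m : ℝ) = (x - √Δ * T) * (x + √Δ * T) := by
      have := Real.sq_sqrt (by linarith : (0 : ℝ) ≤ Δ)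
      linear_combination -hmx + T ^ 2 * this
    have h1 : T ≤ |(x : ℝ) + √Δ * T| := by
      rw [abs_of_nonneg (by positivity)]; nlinarith
    rw [le_div_iff₀ hT0, e, abs_mul]
    gcongr
  have hE : (x : ℝ) * x₀ * Q - Δ * t * T * P
      = x₀ * Q * (x - √Δ * T) + Δ * t * T * (√(1 + 4 * v) * Q - P) := by
    linear_combination T * Q * hsqrt
  have h8v : 8 * |v| ≤ 2 * |(m₀ : ℝ)| / t ^ 2 := by
    rw [hv, le_div_iff₀ (by positivity), mul_div_assoc', div_mul_eq_mul_div,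
      div_le_iff₀ (by positivity)]
    nlinarith [mul_nonneg (mul_nonneg (abs_nonneg (m₀ : ℝ)) (sq_nonneg t)) (sub_nonneg.2 hΔR)]
  have hup : |(x : ℝ) * x₀ * Q - Δ * t * T * P| ≤
      4 * Δ * t * 8 ^ a * (|(m : ℝ)| / T + T * (2 * |(m₀ : ℝ)| / t ^ 2) ^ (a + b + 1)) := by
    have hpow : (2 : ℝ) ^ (2 * a + b) ≤ 8 ^ a := by
      calc (2 : ℝ) ^ (2 * a + b) ≤ 2 ^ (3 * a) := pow_le_pow_right₀ (by norm_num) (by omega)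
        _ = 8 ^ a := by rw [pow_mul]; norm_num
    have hQle : |Q| ≤ 2 * 8 ^ a := by
      refine (abs_aeval_padeQ_le b ha hv16).trans ?_
      rw [pow_succ]; linarith
    have hRle : |√(1 + 4 * v) * Q - P| ≤ 4 * 8 ^ a * (2 * |(m₀ : ℝ)| / t ^ 2) ^ (a + b + 1) := by
      refine (abs_sqrt_mul_padeQ_sub_padeP_le b ha hv16).trans ?_
      gcongr
      rw [pow_add]; linarith
    rw [hE]
    refine (abs_add_le _ _).trans ?_
    rw [abs_mul, abs_mul, abs_mul, abs_of_nonneg hx₀R,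
      abs_of_nonneg (by positivity : 0 ≤ (Δ : ℝ) * t * T)]
    calc (x₀ : ℝ) * |Q| * |(x : ℝ) - √Δ * T| + Δ * t * T * |√(1 + 4 * v) * Q - P|
        ≤ (2 * Δ * t) * (2 * 8 ^ a) * (|(m : ℝ)| / T)
          + Δ * t * T * (4 * 8 ^ a * (2 * |(m₀ : ℝ)| / t ^ 2) ^ (a + b + 1)) := by gcongr
      _ = _ := by ring
  rw [abs_mul, abs_of_pos (by positivity : 0 < (4 * (Δ : ℝ) * t ^ 2) ^ a)] at hlow
  have hfin := hlow.trans (mul_le_mul_of_nonneg_left hup (by positivity))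
  have hpos : 0 < T * t ^ (2 * (a + b + 1)) := by positivity
  have hmul := mul_le_mul_of_nonneg_right hfin hpos.le
  have hl : t ^ (2 * (a - b)) * (T * t ^ (2 * (a + b + 1)))
      = t ^ (2 * a) * (T * t ^ (2 * (a + 1))) := by
    have : t ^ (2 * (a - b)) * t ^ (2 * (a + b + 1)) = t ^ (2 * a) * t ^ (2 * (a + 1)) := by
      rw [← pow_add, ← pow_add]; congr 1; omega
    linear_combination T * this
  have hr : (4 * (Δ : ℝ) * t ^ 2) ^ a * (4 * Δ * t * 8 ^ a *
        (|(m : ℝ)| / T + T * (2 * |(m₀ : ℝ)| / t ^ 2) ^ (a + b + 1)))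
        * (T * t ^ (2 * (a + b + 1)))
      = t ^ (2 * a) * (4 * Δ * (32 * Δ) ^ a * t *
      (|(m : ℝ)| * t ^ (2 * (a + b + 1)) + T ^ 2 * (2 * |(m₀ : ℝ)|) ^ (a + b + 1))) := by
    rw [div_pow, ← pow_mul, show (32 : ℝ) * Δ = 4 * Δ * 8 by ring, mul_pow (4 * (Δ : ℝ)) 8,
      mul_pow (4 * (Δ : ℝ)) (t ^ 2), ← pow_mul]
    field_simp
  rw [hl, hr] at hmul
  exact le_of_mul_le_mul_left hmul (by positivity)

theorem sq_sub_mul_nine_pow_ne_zero {Δ : ℤ} (hΔ : ¬IsSquare Δ) (x : ℤ) (n : ℕ) :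
    x ^ 2 - Δ * 9 ^ n ≠ 0 := by
  intro h
  have h9 : (9 : ℤ) ^ n = (3 ^ n) ^ 2 := by rw [← pow_mul, mul_comm, pow_mul]; norm_num
  rw [h9, sub_eq_zero] at h
  obtain ⟨y, rfl⟩ := (Int.pow_dvd_pow_iff two_ne_zero).1 (Dvd.intro_left _ h.symm)
  refine hΔ ⟨y, mul_right_cancel₀ (pow_ne_zero 2 (pow_ne_zero n three_ne_zero)) (h.symm.trans ?_)⟩
  ring

theorem exists_pade_ne_zero {v : ℝ} (hv : v ≠ 0) {k : ℕ} (hk : 0 < k) (A : ℝ) {B : ℝ}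
    (hB : B ≠ 0) : ∃ b, (b = k ∨ b = k + 1) ∧
      A * aeval v (padeQ (2 * k) b) - B * aeval v (padeP (2 * k) b) ≠ 0 := by
  by_contra! h
  have h1 := h k (Or.inl rfl)
  have h2 := h (k + 1) (Or.inr rfl)
  obtain ⟨c, hc, hdet⟩ := exists_padeP_mul_padeQ_sub (a := 2 * k) k (by omega)
  have hev := congrArg (aeval v) hdet
  simp only [map_sub, map_mul, map_pow, aeval_X, aeval_C] at hev
  have h0 : B * ((algebraMap ℤ ℝ) c * v ^ (2 * k + k + 1)) = 0 := by
    rw [← hev]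
    linear_combination aeval v (padeQ (2 * k) k) * h2 - aeval v (padeQ (2 * k) (k + 1)) * h1
  have hc' : (algebraMap ℤ ℝ) c ≠ 0 := by simpa using hc
  exact mul_ne_zero hB (mul_ne_zero hc' (pow_ne_zero _ hv)) h0

theorem le_pow_of_pade_bound {t T m m₀ Δ : ℝ} {k : ℕ} (hk : 12 ≤ k) (hΔ : 1 ≤ Δ) (hm : 0 ≤ m)
    (hm₀ : 1 ≤ m₀) (hG : (2 ^ 17 * Δ ^ 3 * m₀ ^ 4) ^ 2 ≤ t) (hT1 : t ^ (3 * k) ≤ T)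
    (hT2 : T ≤ t ^ (3 * k + 3))
    (h : T * t ^ (2 * (2 * k + 1)) ≤ 4 * Δ * (32 * Δ) ^ (2 * k) * t *
      (m * t ^ (2 * (3 * k + 2)) + T ^ 2 * (2 * m₀) ^ (4 * k))) :
    T ≤ m ^ 16 := by
  set G := 2 ^ 17 * Δ ^ 3 * m₀ ^ 4 with hGdef
  have hG1 : 1 ≤ G := by
    have h1 : 1 ≤ Δ ^ 3 := one_le_pow₀ hΔ
    have h2 : 1 ≤ m₀ ^ 4 := one_le_pow₀ hm₀
    have h3 : 1 ≤ Δ ^ 3 * m₀ ^ 4 := one_le_mul_of_one_le_of_one_le h1 h2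
    rw [hGdef]; nlinarith
  have ht1 : 1 ≤ t := (one_le_pow₀ hG1).trans hG
  have ht0 : 0 < t := by linarith
  have hT0 : 0 < T := (pow_pos ht0 _).trans_le hT1
  have hGk : 8 * Δ * (32 * Δ) ^ (2 * k) * (2 * m₀) ^ (4 * k) ≤ G ^ k := by
    have h1 : 8 * Δ ≤ (8 * Δ) ^ k := le_self_pow₀ (by linarith) (by omega)
    calc 8 * Δ * (32 * Δ) ^ (2 * k) * (2 * m₀) ^ (4 * k)
        ≤ (8 * Δ) ^ k * (32 * Δ) ^ (2 * k) * (2 * m₀) ^ (4 * k) := by gcongr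
      _ = G ^ k := by
        rw [pow_mul, pow_mul, ← mul_pow, ← mul_pow, hGdef]; congr 1; ring
  have hGk' : 8 * Δ * (32 * Δ) ^ (2 * k) ≤ G ^ k := by
    refine le_trans (le_mul_of_one_le_right (by positivity) ?_) hGk
    exact one_le_pow₀ (by linarith)
  have hGsq : (G ^ k) ^ 2 ≤ t ^ k := by
    rw [← pow_mul, mul_comm, pow_mul]
    exact pow_le_pow_left₀ (by positivity) hG k
  obtain ⟨j, rfl⟩ : ∃ j, k = j + 12 := ⟨k - 12, by omega⟩
  have hGle : G ^ (j + 12) ≤ t ^ (j + 10) := by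
    refine (sq_le_sq₀ (by positivity) (by positivity)).1 (hGsq.trans ?_)
    rw [← pow_mul]
    exact pow_le_pow_right₀ ht1 (by omega)
  generalize G ^ (j + 12) = g at *
  have hg0 : 0 ≤ g := le_trans (by positivity) hGk'
  have hA : g * t * T ^ 2 ≤ T * t ^ (2 * (2 * (j + 12) + 1)) := by
    calc g * t * T ^ 2 = g * t * T * T := by ring
      _ ≤ t ^ (j + 10) * t * t ^ (3 * (j + 12) + 3) * T := by gcongr
      _ = T * t ^ (2 * (2 * (j + 12) + 1)) := by ring
  have hB : T * t ^ (2 * (2 * (j + 12) + 1)) ≤ g * t * (m * t ^ (2 * (3 * (j + 12) + 2))) := by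
    have h1 : 8 * Δ * (32 * Δ) ^ (2 * (j + 12)) * (t * (m * t ^ (2 * (3 * (j + 12) + 2))))
        ≤ g * (t * (m * t ^ (2 * (3 * (j + 12) + 2)))) := by gcongr
    have h2 : 8 * Δ * (32 * Δ) ^ (2 * (j + 12)) * (2 * m₀) ^ (4 * (j + 12)) * (t * T ^ 2)
        ≤ g * (t * T ^ 2) := by gcongr
    linarith
  have hC : t ^ (j + 12) ≤ g * m * t ^ 3 := by
    have h1 : t ^ (3 * (j + 12)) * t ^ (2 * (2 * (j + 12) + 1))
        ≤ g * t * (m * t ^ (2 * (3 * (j + 12) + 2))) :=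
      (mul_le_mul_of_nonneg_right hT1 (by positivity)).trans hB
    refine le_of_mul_le_mul_right (a := t ^ (6 * j + 74)) ?_ (by positivity)
    calc t ^ (j + 12) * t ^ (6 * j + 74)
        = t ^ (3 * (j + 12)) * t ^ (2 * (2 * (j + 12) + 1)) := by ring
      _ ≤ _ := h1
      _ = _ := by ring
  have hD : t ^ (j + 12) ≤ m ^ 2 * t ^ 6 := by
    have h1 := pow_le_pow_left₀ (by positivity) hC 2
    refine le_of_mul_le_mul_right (a := t ^ (j + 12)) ?_ (by positivity)
    calc t ^ (j + 12) * t ^ (j + 12) = (t ^ (j + 12)) ^ 2 := by ring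
      _ ≤ (g * m * t ^ 3) ^ 2 := h1
      _ = g ^ 2 * (m ^ 2 * t ^ 6) := by ring
      _ ≤ t ^ (j + 12) * (m ^ 2 * t ^ 6) := by gcongr
      _ = _ := by ring
  have hE : t ^ (j + 12) ≤ m ^ 4 := by
    have h1 := pow_le_pow_left₀ (by positivity) hD 2
    have h2 : t ^ 12 ≤ t ^ (j + 12) := pow_le_pow_right₀ ht1 (by omega)
    refine le_of_mul_le_mul_right (a := t ^ (j + 12)) ?_ (by positivity)
    calc t ^ (j + 12) * t ^ (j + 12) = (t ^ (j + 12)) ^ 2 := by ring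
      _ ≤ (m ^ 2 * t ^ 6) ^ 2 := h1
      _ = m ^ 4 * t ^ 12 := by ring
      _ ≤ m ^ 4 * t ^ (j + 12) := by gcongr
  calc T ≤ t ^ (3 * (j + 12) + 3) := hT2
    _ ≤ t ^ ((j + 12) * 4) := pow_le_pow_right₀ ht1 (by omega)
    _ = (t ^ (j + 12)) ^ 4 := by rw [pow_mul]
    _ ≤ (m ^ 4) ^ 4 := by gcongr
    _ = m ^ 16 := by ring

/-- A single very good approximation of `√Δ` by a fraction with denominator `3 ^ n₀` limits the
quality of all other approximations with denominators `3 ^ n`. -/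
theorem three_pow_le_of_anchor {Δ x₀ x : ℤ} {n₀ n : ℕ} (hΔ : 1 ≤ Δ) (hsq : ¬IsSquare Δ)
    (hx₀ : 0 ≤ x₀) (hx : 0 ≤ x) (hn₀ : 0 < n₀) (hn : 36 * n₀ ≤ n)
    (hG : (2 ^ 17 * Δ ^ 3 * |x₀ ^ 2 - Δ * 9 ^ n₀| ^ 4) ^ 2 ≤ 3 ^ n₀) :
    3 ^ n ≤ |x ^ 2 - Δ * 9 ^ n| ^ 16 := by
  have hm₀ := Int.one_le_abs (sq_sub_mul_nine_pow_ne_zero hsq x₀ n₀)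
  have h4 : 4 * |x₀ ^ 2 - Δ * 9 ^ n₀| ≤ Δ * 9 ^ n₀ := by
    generalize |x₀ ^ 2 - Δ * 9 ^ n₀| = μ at *
    have e1 : μ ≤ μ ^ 4 := le_self_pow₀ hm₀ (by norm_num)
    have e2 : 1 ≤ Δ ^ 3 := one_le_pow₀ hΔ
    have e3 : μ ^ 4 ≤ Δ ^ 3 * μ ^ 4 := le_mul_of_one_le_left (by positivity) e2
    have e4 : 4 * μ ≤ 2 ^ 17 * Δ ^ 3 * μ ^ 4 := by linarith
    have e5 : 2 ^ 17 * Δ ^ 3 * μ ^ 4 ≤ (2 ^ 17 * Δ ^ 3 * μ ^ 4) ^ 2 :=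
      le_self_pow₀ (by linarith) (by norm_num)
    have e6 : (3 : ℤ) ^ n₀ ≤ 9 ^ n₀ := by gcongr; norm_num
    have e7 : (9 : ℤ) ^ n₀ ≤ Δ * 9 ^ n₀ := le_mul_of_one_le_left (by positivity) hΔ
    linarith
  obtain ⟨k, hk⟩ : ∃ k, k = n / (3 * n₀) := ⟨_, rfl⟩
  have hk12 : 12 ≤ k := by
    rw [hk, Nat.le_div_iff_mul_le (by omega)]; omega
  have hk1 : n₀ * (3 * k) ≤ n := by
    have := Nat.div_mul_le_self n (3 * n₀)
    rw [← hk] at this; linarith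
  have hk2 : n ≤ n₀ * (3 * k + 3) := by
    have := Nat.lt_div_mul_add (a := n) (b := 3 * n₀) (by omega)
    rw [← hk] at this; linarith
  have hΔR : (1 : ℝ) ≤ Δ := by exact_mod_cast hΔ
  have hv : ((x₀ ^ 2 - Δ * 9 ^ n₀ : ℤ) : ℝ) / ((4 * Δ * 9 ^ n₀ : ℤ) : ℝ) ≠ 0 :=
    div_ne_zero (Int.cast_ne_zero.2 (sq_sub_mul_nine_pow_ne_zero hsq x₀ n₀))
      (Int.cast_ne_zero.2 (by positivity))
  obtain ⟨b, hb, hne⟩ := exists_pade_ne_zero hv (k := k) (by omega) ((x : ℝ) * x₀)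
    (B := Δ * 3 ^ n₀ * 3 ^ n) (by positivity)
  have hab : 2 * n₀ * (2 * k - b) ≤ n := by
    calc 2 * n₀ * (2 * k - b) ≤ 2 * n₀ * k := by gcongr; omega
      _ ≤ n := by nlinarith
  have hgap := pade_gap hΔ hx₀ hx (a := 2 * k) (by omega) (by omega) hab rfl h4 hne
  have hm₀R : (1 : ℝ) ≤ |((x₀ ^ 2 - Δ * 9 ^ n₀ : ℤ) : ℝ)| := by exact_mod_cast hm₀
  have hGR : (2 ^ 17 * (Δ : ℝ) ^ 3 * |((x₀ ^ 2 - Δ * 9 ^ n₀ : ℤ) : ℝ)| ^ 4) ^ 2 ≤ 3 ^ n₀ := by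
    exact_mod_cast hG
  have hres : (3 : ℝ) ^ n ≤ |((x ^ 2 - Δ * 9 ^ n : ℤ) : ℝ)| ^ 16 := by
    refine le_pow_of_pade_bound hk12 hΔR (abs_nonneg _) hm₀R hGR ?_ ?_ (hgap.trans ?_)
    · rw [← pow_mul]; exact pow_le_pow_right₀ (by norm_num) hk1
    · rw [← pow_mul]; exact pow_le_pow_right₀ (by norm_num) hk2
    · have h3 : (1 : ℝ) ≤ 3 ^ n₀ := one_le_pow₀ (by norm_num)
      have e1 : ((3 : ℝ) ^ n₀) ^ (2 * (2 * k + b + 1)) ≤ (3 ^ n₀) ^ (2 * (3 * k + 2)) :=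
        pow_le_pow_right₀ h3 (by omega)
      have e2 := pow_le_pow_right₀ (by linarith : 1 ≤ 2 * |((x₀ ^ 2 - Δ * 9 ^ n₀ : ℤ) : ℝ)|)
        (by omega : 2 * k + b + 1 ≤ 4 * k)
      gcongr
  exact_mod_cast hres

theorem exists_three_pow_le {Δ : ℤ} (hΔ : ¬IsSquare Δ) :
    ∃ N : ℕ, ∀ n ≥ N, ∀ x : ℤ, 3 ^ n ≤ |x ^ 2 - Δ * 9 ^ n| ^ 16 := by
  rcases lt_trichotomy Δ 0 with h | h | h
  · refine ⟨0, fun n _ x => ?_⟩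
    have h1 : (3 : ℤ) ^ n ≤ 9 ^ n := by gcongr; norm_num
    have h2 : (9 : ℤ) ^ n ≤ |x ^ 2 - Δ * 9 ^ n| := by
      refine le_trans ?_ (le_abs_self _)
      nlinarith [sq_nonneg x, pow_pos (by norm_num : (0 : ℤ) < 9) n]
    have h3 : (1 : ℤ) ≤ 9 ^ n := one_le_pow₀ (by norm_num)
    exact (h1.trans h2).trans (le_self_pow₀ (h3.trans h2) (by norm_num))
  · exact absurd (h ▸ IsSquare.zero) hΔ
  · obtain ⟨N, hN⟩ := pow_unbounded_of_one_lt ((2 ^ 34 * Δ ^ 6) ^ 2) (by norm_num : (1 : ℤ) < 3)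
    by_cases hall : ∀ n ≥ N + 1, ∀ x : ℤ, 3 ^ n ≤ |x ^ 2 - Δ * 9 ^ n| ^ 16
    · exact ⟨N + 1, hall⟩
    · push Not at hall
      obtain ⟨n₀, hn₀, x₀, hx₀⟩ := hall
      refine ⟨36 * n₀, fun n hn x => ?_⟩
      rw [← sq_abs x₀] at hx₀
      rw [← sq_abs x]
      refine three_pow_le_of_anchor h hΔ (abs_nonneg x₀) (abs_nonneg x) (by omega) hn ?_
      have h1 : (2 ^ 34 * Δ ^ 6) ^ 2 ≤ 3 ^ n₀ :=
        hN.le.trans (pow_le_pow_right₀ (by norm_num) (by omega))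
      refine (sq_le_sq₀ (by positivity) (by positivity)).1 ?_
      calc ((2 ^ 17 * Δ ^ 3 * |(|x₀|) ^ 2 - Δ * 9 ^ n₀| ^ 4) ^ 2) ^ 2
          = (2 ^ 34 * Δ ^ 6) ^ 2 * |(|x₀|) ^ 2 - Δ * 9 ^ n₀| ^ 16 := by ring
        _ ≤ 3 ^ n₀ * 3 ^ n₀ := by gcongr
        _ = (3 ^ n₀) ^ 2 := by ring

/-- Effective exponent bound for the bounded-norm family: fix a nonzero,
non-square quadratic discriminant Δ (so K = ℚ(√Δ) is a quadratic field) and a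
finite set 𝒰 ⊂ ℤ \ {0}. Then there are positive constants A, B (depending only
on 𝒰 and Δ, i.e. on 𝒰 and K) such that for every irreducible polynomial
aX² + bX + c ∈ ℤ[X] of discriminant Δ and height H_f = max(|a|,|b|,|c|), every
solution of a p² + b p 3ⁿ + c 3²ⁿ = u with n ≥ 0 and u ∈ 𝒰 satisfies
n ≤ A (log H_f)² + B. -/
theorem stmt17 (Δ : ℤ) (hΔ0 : Δ ≠ 0) (hΔsq : ¬IsSquare Δ)
    (𝒰 : Finset ℤ) (h𝒰 : (0 : ℤ) ∉ 𝒰) :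
    ∃ A B : ℝ, 0 < A ∧ 0 < B ∧
      ∀ a b c : ℤ,
        Irreducible (C a * X ^ 2 + C b * X + C c : ℤ[X]) →
        b ^ 2 - 4 * a * c = Δ →
        ∀ (p : ℤ) (n : ℕ) (u : ℤ), u ∈ 𝒰 →
          a * p ^ 2 + b * p * 3 ^ n + c * 3 ^ (2 * n) = u →
          (n : ℝ) ≤ A * (Real.log (max a.natAbs (max b.natAbs c.natAbs) : ℝ)) ^ 2 + B := by
  obtain ⟨N, hN⟩ := exists_three_pow_le hΔsq
  obtain ⟨U, hU⟩ : ∃ U : ℕ, ∀ u ∈ 𝒰, u.natAbs ≤ U :=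
    ⟨𝒰.sup Int.natAbs, fun u hu => Finset.le_sup hu⟩
  have hlogU : 0 ≤ Real.log (4 * (U + 1)) := Real.log_nonneg (by
    have : (0 : ℝ) ≤ U := Nat.cast_nonneg U
    linarith)
  refine ⟨16, N + 16 + 16 * Real.log (4 * (U + 1)), by norm_num, by positivity, ?_⟩
  intro a b c _ hdisc p n u hu heq
  have ha : a ≠ 0 := by
    rintro rfl
    exact hΔsq ⟨b, by linarith⟩
  set H : ℝ := max (a.natAbs : ℝ) (max (b.natAbs : ℝ) (c.natAbs : ℝ)) with hH
  have haH : |(a : ℝ)| ≤ H := by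
    rw [hH, ← Int.cast_abs, Int.abs_eq_natAbs]
    exact le_max_left _ _
  have hH1 : 1 ≤ H := by
    have : (1 : ℝ) ≤ |(a : ℝ)| := by exact_mod_cast Int.one_le_abs ha
    linarith
  rcases lt_or_ge n N with hn | hn
  · have : (n : ℝ) ≤ N := by exact_mod_cast hn.le
    nlinarith [sq_nonneg (Real.log H)]
  · have hm : (2 * a * p + b * 3 ^ n) ^ 2 - Δ * 9 ^ n = 4 * a * u := by
      have h9 : (9 : ℤ) ^ n = 3 ^ (2 * n) := by rw [pow_mul]; norm_num
      rw [← hdisc, ← heq, h9]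
      ring
    have h1 := hN n hn (2 * a * p + b * 3 ^ n)
    rw [hm] at h1
    have h2 : (3 : ℝ) ^ n ≤ |4 * (a : ℝ) * u| ^ 16 := by exact_mod_cast h1
    have hu' : |(u : ℝ)| ≤ U + 1 := by
      have : (u.natAbs : ℝ) ≤ U := by exact_mod_cast hU u hu
      rw [← Int.cast_abs, Int.abs_eq_natAbs, Int.cast_natCast]
      linarith
    have h3 : (3 : ℝ) ^ n ≤ (H * (4 * (U + 1))) ^ 16 := by
      refine h2.trans (pow_le_pow_left₀ (abs_nonneg _) ?_ 16)
      rw [abs_mul, abs_mul, abs_of_pos (by norm_num : (0 : ℝ) < 4)]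
      calc 4 * |(a : ℝ)| * |(u : ℝ)| ≤ 4 * H * (U + 1) := by gcongr
        _ = H * (4 * (U + 1)) := by ring
    have h4 := Real.log_le_log (by positivity) h3
    rw [Real.log_pow, Real.log_pow, Real.log_mul (by positivity) (by positivity)] at h4
    have hlog3 : 1 ≤ Real.log 3 := by
      rw [Real.le_log_iff_exp_le (by norm_num)]
      linarith [Real.exp_one_lt_d9]
    have hn0 : (0 : ℝ) ≤ n := Nat.cast_nonneg n
    have hN0 : (0 : ℝ) ≤ N := Nat.cast_nonneg N
    push_cast at h4
    nlinarith [sq_nonneg (Real.log H - 1 / 2), mul_le_mul_of_nonneg_left hlog3 hn0]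
end
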